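/- Let M, N ≥ 1 be integers, let φ : [1,∞) → (0,1] be non-increasing, and let L ∈ ℝ^{M×N} be φ-semi multiplicatively badly approximable. Then there is a constant c > 0 depending only on M and N such that for every real Q ≥ 2: Σ_{q ∈ ([−Q,Q]^N ∩ ℤ^N) \ {0}} ∏_{i=1}^M ‖L_i(q)‖^{−1} ≤ c · [ Q^N · (log(Q^N/φ(Q)))^M + (Q^N/φ(Q)) · (log(Q^N/φ(Q)))^{M−1} ]. -/

import Mathlib

open scoped BigOperators

/-- distance from a real number to the nearest integer -/
noncomputable def distNearestInt (x : ℝ) : ℝ := |x - (round x : ℤ)|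

/-- A finite set of integer points whose coordinates in a basis `v` of maximal determinant lie in
`[-1, 1]` has at most `5 ^ d * |det v|` elements. -/
lemma card_le_mul_natAbs_det {ι : Type*} [Fintype ι] [DecidableEq ι] (S : Finset (ι → ℤ))
    (v : Matrix ι ι ℤ) (hv : v.det ≠ 0)
    (hmax : ∀ x ∈ S, ∀ i, |(v.updateRow i x).det| ≤ |v.det|) :
    S.card ≤ 5 ^ Fintype.card ι * v.det.natAbs := by
  classical
  have hli : LinearIndependent ℤ v.row := Matrix.linearIndependent_rows_of_det_ne_zero hv
  set P : Submodule ℤ (ι → ℤ) := Submodule.span ℤ (Set.range v.row) with hP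
  have hcard : Nat.card ((ι → ℤ) ⧸ P) = v.det.natAbs := by
    rw [← Submodule.natAbs_det_basis_change (Pi.basisFun ℤ ι) P (Module.Basis.span hli),
      Pi.basisFun_det_apply]
    congr 2
    ext i j
    exact congrFun (congrArg Subtype.val (Module.Basis.span_apply hli i)) j
  have hfin : Finite ((ι → ℤ) ⧸ P) :=
    Nat.finite_of_card_ne_zero (by rw [hcard]; exact Int.natAbs_ne_zero.mpr hv)
  have : Fintype ((ι → ℤ) ⧸ P) := Fintype.ofFinite _
  rw [← hcard, Nat.card_eq_fintype_card, ← Finset.card_univ (α := (ι → ℤ) ⧸ P)]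
  refine Finset.card_le_mul_card_image_of_maps_to (f := P.mkQ) (by simp) _ fun b _ => ?_
  rcases (S.filter fun x => P.mkQ x = b).eq_empty_or_nonempty with he | ⟨x₀, hx₀⟩
  · rw [he]; simp
  rw [Finset.mem_filter] at hx₀
  have hbox : (Fintype.piFinset fun _ : ι => Finset.Icc (-2 : ℤ) 2).card
      = 5 ^ Fintype.card ι := by simp
  rw [← hbox]
  refine Finset.card_le_card_of_surjOn (fun n => x₀ + v.transpose.mulVec n) ?_
  intro x hx
  simp only [Finset.coe_filter, Set.mem_ofPred_eq] at hx
  have hmem : x - x₀ ∈ P := by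
    rw [← Submodule.ker_mkQ P, LinearMap.mem_ker, map_sub, hx.2, hx₀.2, sub_self]
  obtain ⟨n, hn⟩ := (Submodule.mem_span_range_iff_exists_fun ℤ).1 hmem
  have hn' : v.transpose.mulVec n = x - x₀ := by
    rw [← hn]
    ext j
    simp [Matrix.mulVec, dotProduct, Matrix.row, mul_comm]
  refine ⟨n, ?_, by simp [hn']⟩
  have hcr : v.transpose.cramer (x - x₀) = v.det • n := by
    rw [← hn', Matrix.cramer_eq_adjugate_mulVec, Matrix.mulVec_mulVec, Matrix.adjugate_mul,
      Matrix.smul_mulVec, Matrix.one_mulVec, Matrix.det_transpose]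
  simp only [Fintype.coe_piFinset, Finset.coe_Icc, Set.mem_pi, Set.mem_univ, forall_true_left]
  intro i
  have h1 : v.det * n i = (v.updateRow i x).det - (v.updateRow i x₀).det := by
    have := congrFun hcr i
    rw [map_sub] at this
    simpa [Matrix.cramer_transpose_apply] using this.symm
  have h2 := hmax x hx.1 i
  have h3 := hmax x₀ hx₀.1 i
  have h4 : |v.det| * |n i| ≤ |v.det| * 2 := by
    rw [← abs_mul, h1]
    exact (abs_sub _ _).trans (by linarith)
  have h5 := le_of_mul_le_mul_left h4 (abs_pos.mpr hv)
  exact abs_le.1 h5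

/-- If all determinants with rows in `T` vanish, then `T` lies in a hyperplane. -/
lemma exists_dotProduct_eq_zero_of_det_eq_zero {ι : Type*} [Fintype ι] [DecidableEq ι]
    (T : Set (ι → ℝ)) (hT : ∀ v : Matrix ι ι ℝ, (∀ i, v i ∈ T) → v.det = 0) :
    ∃ f : ι → ℝ, f ≠ 0 ∧ ∀ y ∈ T, ∑ j, f j * y j = 0 := by
  by_cases hspan : Submodule.span ℝ T = ⊤
  · exfalso
    obtain ⟨b, hbT, hb, hli⟩ := exists_linearIndependent ℝ T
    let B : Module.Basis b ℝ (ι → ℝ) := Module.Basis.mk hli (by simp [hb, hspan])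
    let e : b ≃ ι := B.indexEquiv (Pi.basisFun ℝ ι)
    have hu := (Pi.basisFun ℝ ι).isUnit_det (B.reindex e)
    rw [Pi.basisFun_det_apply, hT] at hu
    · simp at hu
    · intro i
      have : (B.reindex e) i = ((e.symm i : b) : ι → ℝ) := by simp [B]
      change (B.reindex e) i ∈ T
      rw [this]
      exact hbT (e.symm i).2
  · obtain ⟨f, hf, hle⟩ := Submodule.exists_le_ker_of_lt_top _ (lt_top_iff_ne_top.2 hspan)
    have hrep : ∀ y, f y = ∑ j, f (Pi.single j 1) * y j := by
      intro y
      conv_lhs => rw [pi_eq_sum_univ' y]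
      simp [mul_comm]
    refine ⟨fun j => f (Pi.single j 1), ?_, fun y hy => ?_⟩
    · intro h0
      apply hf
      ext y
      simp [congrFun h0 y]
    · rw [← hrep]
      exact hle (Submodule.subset_span hy)

/-- Packing bound for points of the unit cube that lie in a hyperplane. -/
lemma card_le_of_hyperplane_of_separated {α ι : Type*} [Fintype ι] [DecidableEq ι]
    (S : Finset α) (y : α → ι → ℝ) (μ : ℝ) (hμ : 0 < μ) (hμ1 : μ ≤ 1)
    (hcube : ∀ a ∈ S, ∀ i, |y a i| ≤ 1)
    (hsep : ∀ a ∈ S, ∀ b ∈ S, (∀ i, |y a i - y b i| < μ) → a = b)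
    (f : ι → ℝ) (hf : f ≠ 0) (hfy : ∀ a ∈ S, ∑ j, f j * y a j = 0) :
    (S.card : ℝ) ≤ (4 * Fintype.card ι / μ) ^ (Fintype.card ι - 1) := by
  classical
  obtain ⟨k, hk⟩ := Function.ne_iff.1 hf
  obtain ⟨j, -, hj⟩ := Finset.exists_max_image Finset.univ (fun i => |f i|) ⟨k, by simp⟩
  have hfj : 0 < |f j| := (abs_pos.2 hk).trans_le (hj k (by simp))
  set d : ℝ := (Fintype.card ι : ℝ) with hd
  have hd1 : 1 ≤ d := by
    have : 0 < Fintype.card ι := Fintype.card_pos_iff.2 ⟨j⟩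
    rw [hd]
    exact_mod_cast this
  set ε : ℝ := μ / d with hε
  have hεpos : 0 < ε := by positivity
  have hεμ : ε ≤ μ := div_le_self hμ.le hd1
  let cell : α → ({i // i ≠ j} → ℤ) := fun a i => ⌊y a i / ε⌋
  let C : Finset ({i // i ≠ j} → ℤ) :=
    Fintype.piFinset fun _ => Finset.Icc ⌊-1 / ε⌋ ⌊1 / ε⌋
  have hmaps : Set.MapsTo cell S C := by
    intro a ha
    simp only [C, Fintype.coe_piFinset, Set.mem_pi, Finset.coe_Icc, Set.mem_Icc, cell]
    intro i _
    have := abs_le.1 (hcube a ha i)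
    constructor <;> apply Int.floor_le_floor <;> gcongr
    exacts [this.1, this.2]
  have hinj : Set.InjOn cell S := by
    intro a ha b hb hab
    have hne : ∀ i, i ≠ j → |y a i - y b i| < ε := by
      intro i hi
      have h := Int.abs_sub_lt_one_of_floor_eq_floor (congrFun hab ⟨i, hi⟩)
      rwa [← sub_div, abs_div, abs_of_pos hεpos, div_lt_one hεpos] at h
    refine hsep a ha b hb fun i => ?_
    by_cases hi : i = j
    · subst hi
      have h0 : f i * (y a i - y b i) =
          -∑ l ∈ Finset.univ.erase i, f l * (y a l - y b l) := by
        rw [eq_neg_iff_add_eq_zero, Finset.add_sum_erase _ (fun l => f l * (y a l - y b l)) (Finset.mem_univ i)]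
        simp [mul_sub, Finset.sum_sub_distrib, hfy a ha, hfy b hb]
      have h1 : |f i| * |y a i - y b i| ≤ |f i| * ((d - 1) * ε) := by
        rw [← abs_mul, h0, abs_neg]
        refine (Finset.abs_sum_le_sum_abs _ _).trans ?_
        calc ∑ l ∈ Finset.univ.erase i, |f l * (y a l - y b l)|
            ≤ ∑ l ∈ Finset.univ.erase i, |f i| * ε := by
              refine Finset.sum_le_sum fun l hl => ?_
              rw [abs_mul]
              exact mul_le_mul (hj l (by simp)) (hne l (Finset.ne_of_mem_erase hl)).le
                (abs_nonneg _) (abs_nonneg _)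
          _ = |f i| * ((d - 1) * ε) := by
              rw [Finset.sum_const, Finset.card_erase_of_mem (Finset.mem_univ i),
                Finset.card_univ, nsmul_eq_mul,
                Nat.cast_sub (Fintype.card_pos_iff.2 ⟨i⟩)]
              push_cast
              ring
      have h2 := le_of_mul_le_mul_left h1 hfj
      have h3 : d * ε = μ := by rw [hε]; field_simp
      nlinarith
    · exact (hne i hi).trans_le hεμ
  have hcard : S.card ≤ C.card := Finset.card_le_card_of_injOn cell hmaps hinj
  have hcell : (((Finset.Icc ⌊-1 / ε⌋ ⌊1 / ε⌋).card : ℕ) : ℝ) ≤ 4 * d / μ := by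
    rw [Int.card_Icc]
    have h1 : ⌊-1 / ε⌋ ≤ ⌊1 / ε⌋ := by
      apply Int.floor_le_floor; gcongr; norm_num
    have h2 : (((⌊1 / ε⌋ + 1 - ⌊-1 / ε⌋).toNat : ℤ) : ℝ) = ⌊1 / ε⌋ + 1 - ⌊-1 / ε⌋ := by
      rw [Int.toNat_of_nonneg (by omega)]; push_cast; ring
    rw [Int.cast_natCast] at h2
    rw [h2]
    have h3 := Int.floor_le (1 / ε)
    have h4 := Int.sub_one_lt_floor (-1 / ε)
    have h5 : 1 ≤ 1 / ε := by rw [le_div_iff₀ hεpos]; linarith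
    have h6 : 4 * d / μ = 4 * (1 / ε) := by rw [hε]; field_simp
    have h7 : -1 / ε = -(1 / ε) := by ring
    rw [h7] at h4
    rw [h6, h7]
    linarith
  calc (S.card : ℝ) ≤ C.card := by exact_mod_cast hcard
    _ = ((Finset.Icc ⌊-1 / ε⌋ ⌊1 / ε⌋).card : ℝ) ^ (Fintype.card ι - 1) := by
      simp only [C, Fintype.card_piFinset, Finset.prod_const, Finset.card_univ]
      rw [Fintype.card_subtype_compl, Fintype.card_subtype_eq]
      push_cast
      rfl
    _ ≤ _ := by gcongr

/-- Lattice points in the unit cube: either their number is controlled by the covolume, or they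
lie in a hyperplane and it is controlled by the separation. -/
lemma card_mul_abs_det_le_or_card_le {ι : Type*} [Fintype ι] [DecidableEq ι]
    (S : Finset (ι → ℤ)) (A : Matrix ι ι ℝ) (μ : ℝ) (hμ : 0 < μ) (hμ1 : μ ≤ 1)
    (hcube : ∀ z ∈ S, ∀ i, |A.mulVec (fun j => (z j : ℝ)) i| ≤ 1)
    (hsep : ∀ z : ι → ℤ, z ≠ 0 → ∃ i, μ ≤ |A.mulVec (fun j => (z j : ℝ)) i|) :
    (S.card : ℝ) * |A.det| ≤ 5 ^ Fintype.card ι * (Fintype.card ι).factorial ∨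
      (S.card : ℝ) ≤ (4 * Fintype.card ι / μ) ^ (Fintype.card ι - 1) := by
  classical
  have hdet : ∀ w : Matrix ι ι ℤ,
      (Matrix.of fun i => A.mulVec (fun j => (w i j : ℝ))).det = (w.det : ℝ) * A.det := by
    intro w
    have : (Matrix.of fun i => A.mulVec (fun j => (w i j : ℝ))) =
        w.map (Int.castRingHom ℝ) * A.transpose := by
      ext i j
      simp [Matrix.mulVec, dotProduct, Matrix.mul_apply, mul_comm]
    rw [this, Matrix.det_mul, Matrix.det_transpose]
    congr 1
    exact ((Int.castRingHom ℝ).map_det w).symm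
  by_cases h : ∃ w : Matrix ι ι ℤ, (∀ i, w i ∈ S) ∧ w.det ≠ 0
  · left
    obtain ⟨w, hw, hw0⟩ := h
    obtain ⟨v, hv, hmax⟩ := Finset.exists_max_image (Fintype.piFinset fun _ : ι => S)
      (fun u : ι → ι → ℤ => |(Matrix.of u).det|) ⟨w, Fintype.mem_piFinset.2 hw⟩
    rw [Fintype.mem_piFinset] at hv
    have hv0 : (Matrix.of v).det ≠ 0 := by
      have := hmax w (Fintype.mem_piFinset.2 hw)
      exact abs_pos.1 ((abs_pos.2 hw0).trans_le this)
    have hcard := card_le_mul_natAbs_det S (Matrix.of v) hv0 fun x hx i => by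
      refine hmax (Function.update v i x) ?_
      rw [Fintype.mem_piFinset]
      intro l
      by_cases hl : l = i
      · subst hl; simpa using hx
      · simpa [hl] using hv l
    have hle := Matrix.det_le (A := Matrix.of fun i => A.mulVec (fun j => (v i j : ℝ)))
      (abv := AbsoluteValue.abs) (x := (1 : ℝ)) (fun i j => by simpa using hcube (v i) (hv i) j)
    have hd := hdet (Matrix.of v)
    simp only [Matrix.of_apply] at hd
    rw [hd] at hle
    simp only [AbsoluteValue.abs_apply, one_pow, nsmul_eq_mul, mul_one, abs_mul] at hle
    have hcard' : (S.card : ℝ) ≤ 5 ^ Fintype.card ι * |((Matrix.of v).det : ℝ)| := by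
      have : (S.card : ℝ) ≤ ((5 ^ Fintype.card ι * (Matrix.of v).det.natAbs : ℕ) : ℝ) := by
        exact_mod_cast hcard
      simpa [Nat.cast_natAbs] using this
    calc (S.card : ℝ) * |A.det| ≤ 5 ^ Fintype.card ι * |((Matrix.of v).det : ℝ)| * |A.det| := by
          gcongr
      _ ≤ _ := by rw [mul_assoc]; gcongr
  · right
    push Not at h
    obtain ⟨f, hf, hfy⟩ := exists_dotProduct_eq_zero_of_det_eq_zero
      (Set.image (fun z : ι → ℤ => A.mulVec (fun j => (z j : ℝ))) S) (by
        intro u hu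
        choose w hw hwu using hu
        have : u = Matrix.of fun i => A.mulVec (fun j => (w i j : ℝ)) := by
          ext i j; exact (congrFun (hwu i) j).symm
        rw [this]
        have h0 := hdet (Matrix.of w)
        rw [h (Matrix.of w) hw] at h0
        simpa using h0)
    refine card_le_of_hyperplane_of_separated S (fun z => A.mulVec (fun j => (z j : ℝ))) μ hμ hμ1
      hcube ?_ f hf (fun z hz => hfy _ ⟨z, hz, rfl⟩)
    intro a _ b _ hab
    by_contra hne
    obtain ⟨i, hi⟩ := hsep (a - b) (sub_ne_zero.2 hne)
    refine absurd (hab i) (not_lt.2 ?_)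
    have : (fun j => (((a - b) j : ℤ) : ℝ)) = (fun j => (a j : ℝ)) - fun j => (b j : ℝ) := by
      ext j; simp
    rwa [this, Matrix.mulVec_sub] at hi

lemma distNearestInt_le_abs_add (x : ℝ) (p : ℤ) : distNearestInt x ≤ |x + p| := by
  have := round_le x (-p)
  simpa [distNearestInt] using this

/-- Number of integer points `q` in a cube for which all `‖L_i(q)‖` are small. -/
lemma card_le_of_distNearestInt_le {M N : ℕ} (hN : 1 ≤ N) (L : Matrix (Fin M) (Fin N) ℝ)
    (Q φ₀ μ : ℝ) (hQ : 0 < Q) (hμ : 0 < μ) (hμ1 : μ ≤ 1)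
    (s : Fin M → ℝ) (hs : ∀ i, 0 < s i) (hs1 : ∀ i, s i ≤ 1)
    (hL : ∀ q : Fin N → ℤ, q ≠ 0 → ‖(fun j => (q j : ℝ))‖ ≤ Q →
      φ₀ ≤ ‖(fun j => (q j : ℝ))‖ ^ N * ∏ i, distNearestInt (∑ j, L i j * (q j : ℝ)))
    (hμφ : μ ^ (M + N) * ((∏ i, s i) * Q ^ N) ≤ φ₀)
    (F : Finset (Fin N → ℤ)) (hFQ : ∀ q ∈ F, ∀ j, |(q j : ℝ)| ≤ Q)
    (hFs : ∀ q ∈ F, ∀ i, distNearestInt (∑ j, L i j * (q j : ℝ)) ≤ s i) :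
    (F.card : ℝ) ≤ 5 ^ (M + N) * (M + N).factorial * (Q ^ N * ∏ i, s i) +
      (4 * (M + N : ℕ) / μ) ^ (M + N - 1) := by
  classical
  let A : Matrix (Fin M ⊕ Fin N) (Fin M ⊕ Fin N) ℝ :=
    Matrix.fromBlocks (Matrix.diagonal fun i => (s i)⁻¹) (Matrix.of fun i j => (s i)⁻¹ * L i j)
      0 (Matrix.diagonal fun _ => Q⁻¹)
  have hAl : ∀ (z : Fin M ⊕ Fin N → ℤ) (i : Fin M), A.mulVec (fun j => (z j : ℝ)) (Sum.inl i) =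
      (∑ j, L i j * (z (Sum.inr j) : ℝ) + z (Sum.inl i)) / s i := by
    intro z i
    simp only [A, Matrix.mulVec, dotProduct, Fintype.sum_sum_type, Matrix.fromBlocks_apply₁₁,
      Matrix.fromBlocks_apply₁₂, Matrix.diagonal_apply, Matrix.of_apply, ite_mul, zero_mul,
      Finset.sum_ite_eq, Finset.mem_univ, if_true, mul_assoc, ← Finset.mul_sum]
    ring
  have hAr : ∀ (z : Fin M ⊕ Fin N → ℤ) (j : Fin N), A.mulVec (fun j => (z j : ℝ)) (Sum.inr j) =
      z (Sum.inr j) / Q := by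
    intro z j
    simp only [A, Matrix.mulVec, dotProduct, Fintype.sum_sum_type, Matrix.fromBlocks_apply₂₁,
      Matrix.fromBlocks_apply₂₂, Matrix.diagonal_apply, ite_mul, zero_mul, Matrix.zero_apply,
      Finset.sum_ite_eq, Finset.mem_univ, if_true, Finset.sum_const_zero, zero_add]
    ring
  have hprod : 0 < ∏ i, s i := Finset.prod_pos fun i _ => hs i
  have hdet : |A.det| = (Q ^ N * ∏ i, s i)⁻¹ := by
    have : A.det = (Q ^ N * ∏ i, s i)⁻¹ := by
      simp [A, Matrix.det_fromBlocks_zero₂₁, mul_comm]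
    rw [this, abs_of_pos (by positivity)]
  let toLattice : (Fin N → ℤ) → (Fin M ⊕ Fin N → ℤ) :=
    fun q => Sum.elim (fun i => -round (∑ j, L i j * (q j : ℝ))) q
  have hinj : Function.Injective toLattice := by
    intro q q' h
    ext j
    simpa [toLattice] using congrFun h (Sum.inr j)
  have hcard : (F.image toLattice).card = F.card := Finset.card_image_of_injective _ hinj
  have key := card_mul_abs_det_le_or_card_le (F.image toLattice) A μ hμ hμ1 ?_ ?_
  · rw [hcard, hdet, Fintype.card_sum, Fintype.card_fin, Fintype.card_fin] at key
    have h1 : 0 ≤ (5 : ℝ) ^ (M + N) * (M + N).factorial * (Q ^ N * ∏ i, s i) := by positivity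
    have h2 : 0 ≤ (4 * (M + N : ℕ) / μ) ^ (M + N - 1) := by positivity
    rcases key with key | key
    · rw [← div_eq_mul_inv, div_le_iff₀ (by positivity)] at key
      linarith
    · linarith
  · intro z hz i
    obtain ⟨q, hq, rfl⟩ := Finset.mem_image.1 hz
    rcases i with i | j
    · rw [hAl, abs_div, abs_of_pos (hs i), div_le_one (hs i)]
      simpa [toLattice, distNearestInt, sub_eq_add_neg] using hFs q hq i
    · rw [hAr, abs_div, abs_of_pos hQ, div_le_one hQ]
      exact hFQ q hq j
  · intro z hz
    by_contra! hlt
    have hl : ∀ i, |∑ j, L i j * (z (Sum.inr j) : ℝ) + z (Sum.inl i)| < μ * s i := by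
      intro i
      have := hlt (Sum.inl i)
      rwa [hAl, abs_div, abs_of_pos (hs i), div_lt_iff₀ (hs i)] at this
    have hr : ∀ j, |(z (Sum.inr j) : ℝ)| < μ * Q := by
      intro j
      have := hlt (Sum.inr j)
      rwa [hAr, abs_div, abs_of_pos hQ, div_lt_iff₀ hQ] at this
    by_cases hq : (fun j => z (Sum.inr j)) = 0
    · apply hz
      have hq' : ∀ j, z (Sum.inr j) = 0 := fun j => congrFun hq j
      ext i
      rcases i with i | j
      · have h := hl i
        simp only [hq', Int.cast_zero, mul_zero, Finset.sum_const_zero, zero_add] at h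
        have h1 : |(z (Sum.inl i) : ℝ)| < 1 :=
          h.trans_le (mul_le_one₀ hμ1 (hs i).le (hs1 i))
        exact Int.abs_lt_one_iff.1 (by exact_mod_cast h1)
      · exact hq' j
    · have hnorm : ‖(fun j => (z (Sum.inr j) : ℝ))‖ < μ * Q :=
        (pi_norm_lt_iff (by positivity)).2 fun j => by simpa [Real.norm_eq_abs] using hr j
      have h1 := hL _ hq (hnorm.le.trans (mul_le_of_le_one_left hQ.le hμ1))
      have h2 : ∏ i, distNearestInt (∑ j, L i j * (z (Sum.inr j) : ℝ)) ≤ ∏ i, (μ * s i) :=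
        Finset.prod_le_prod (fun i _ => abs_nonneg _) fun i _ =>
          (distNearestInt_le_abs_add _ _).trans (hl i).le
      have h3 : ‖(fun j => (z (Sum.inr j) : ℝ))‖ ^ N < (μ * Q) ^ N :=
        pow_lt_pow_left₀ hnorm (norm_nonneg _) (by omega)
      have h4 : 0 < ∏ i, (μ * s i) := Finset.prod_pos fun i _ => mul_pos hμ (hs i)
      have h5 : ‖(fun j => (z (Sum.inr j) : ℝ))‖ ^ N *
          ∏ i, distNearestInt (∑ j, L i j * (z (Sum.inr j) : ℝ)) < (μ * Q) ^ N * ∏ i, (μ * s i) :=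
        (mul_le_mul_of_nonneg_left h2 (by positivity)).trans_lt (mul_lt_mul_of_pos_right h3 h4)
      have h6 : (μ * Q) ^ N * ∏ i, (μ * s i) = μ ^ (M + N) * ((∏ i, s i) * Q ^ N) := by
        rw [Finset.prod_mul_distrib, Finset.prod_const, Finset.card_univ, Fintype.card_fin]
        ring
      linarith

/-- Exponent vectors with all entries at most `K` and sum at most `K`. -/
def exponentVectors (M K : ℕ) : Finset (Fin M → ℕ) :=
  (Fintype.piFinset fun _ => Finset.range (K + 1)).filter fun k => ∑ i, k i ≤ K

lemma card_exponentVectors_le (M K : ℕ) : (exponentVectors M K).card ≤ (K + 1) ^ M :=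
  (Finset.card_filter_le _ _).trans (by simp)

lemma sum_exponentVectors_pow_le (m K : ℕ) (ρ : ℝ) (hρ : 0 ≤ ρ) (hρ1 : ρ < 1) :
    ∑ k ∈ exponentVectors (m + 1) K, ρ ^ (K + 1 - ∑ i, k i) ≤ (K + 1 : ℝ) ^ m * (1 - ρ)⁻¹ := by
  classical
  let e : (Fin (m + 1) → ℕ) → ℕ × (Fin m → ℕ) := fun k => (K + 1 - ∑ i, k i, Fin.tail k)
  have hinj : Set.InjOn e (exponentVectors (m + 1) K) := by
    intro k hk k' hk' h
    simp only [exponentVectors, Finset.coe_filter, Set.mem_ofPred_eq] at hk hk'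
    simp only [e, Prod.mk.injEq] at h
    have htail : ∀ i : Fin m, k i.succ = k' i.succ := fun i => congrFun h.2 i
    have hsum := h.1
    have h1 := hk.2
    have h2 := hk'.2
    rw [Fin.sum_univ_succ] at h1 h2
    rw [Fin.sum_univ_succ, Fin.sum_univ_succ] at hsum
    simp only [htail] at h1 hsum
    ext i
    refine Fin.cases ?_ htail i
    omega
  calc ∑ k ∈ exponentVectors (m + 1) K, ρ ^ (K + 1 - ∑ i, k i)
      = ∑ x ∈ (exponentVectors (m + 1) K).image e, ρ ^ x.1 := by
        rw [Finset.sum_image hinj]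
    _ ≤ ∑ x ∈ Finset.range (K + 2) ×ˢ (Fintype.piFinset fun _ : Fin m => Finset.range (K + 1)),
          ρ ^ x.1 := by
        refine Finset.sum_le_sum_of_subset_of_nonneg ?_ fun _ _ _ => by positivity
        intro x hx
        obtain ⟨k, hk, rfl⟩ := Finset.mem_image.1 hx
        simp only [exponentVectors, Finset.mem_filter, Fintype.mem_piFinset,
          Finset.mem_range] at hk
        simp only [e, Finset.mem_product, Finset.mem_range, Fintype.mem_piFinset]
        exact ⟨by omega, fun i => hk.1 i.succ⟩
    _ = (K + 1 : ℝ) ^ m * ∑ n ∈ Finset.range (K + 2), ρ ^ n := by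
        rw [Finset.sum_product, Finset.mul_sum]
        simp
    _ ≤ (K + 1 : ℝ) ^ m * (1 - ρ)⁻¹ := by
        gcongr
        rw [← tsum_geometric_of_lt_one hρ hρ1]
        exact (summable_geometric_of_lt_one hρ hρ1).sum_le_tsum _ fun _ _ => by positivity

/-- Dyadic localisation of the distance to the nearest integer. -/
lemma exists_two_pow_near_inv_distNearestInt (x : ℝ) :
    ∃ k : ℕ, 0 < distNearestInt x →
      (2 : ℝ) ^ k ≤ (distNearestInt x)⁻¹ ∧ (distNearestInt x)⁻¹ < 2 ^ (k + 1) := by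
  by_cases hx : 0 < distNearestInt x
  · have h1 : distNearestInt x ≤ 1 := (abs_sub_round x).trans (by norm_num)
    obtain ⟨k, hk⟩ := exists_nat_pow_near ((one_le_inv₀ hx).2 h1) (one_lt_two (α := ℝ))
    exact ⟨k, fun _ => hk⟩
  · exact ⟨0, fun h => absurd h hx⟩

lemma succ_le_three_mul_log {T : ℝ} (hT : 2 ≤ T) {K : ℕ} (hK : (2 : ℝ) ^ K ≤ T) :
    (K + 1 : ℝ) ≤ 3 * Real.log T := by
  have h1 : (K : ℝ) * Real.log 2 ≤ Real.log T := by
    rw [← Real.log_pow]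
    exact Real.log_le_log (by positivity) hK
  have h2 : Real.log 2 ≤ Real.log T := Real.log_le_log (by norm_num) hT
  have h3 : (2 / 3 : ℝ) < Real.log 2 := by linarith [Real.log_two_gt_d9]
  have h4 : (0 : ℝ) ≤ K := K.cast_nonneg
  nlinarith

lemma exists_root_two (d : ℕ) (hd : d ≠ 0) : ∃ ρ : ℝ, 0 < ρ ∧ ρ < 1 ∧ 2 * ρ ^ d = 1 := by
  refine ⟨(1 / 2 : ℝ) ^ (1 / d : ℝ), by positivity, ?_, ?_⟩
  · exact Real.rpow_lt_one (by norm_num) (by norm_num) (by positivity)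
  · rw [← Real.rpow_natCast, ← Real.rpow_mul (by norm_num), one_div_mul_cancel (by positivity)]
    norm_num

/-- Contribution of one dyadic class to the sum of reciprocals. -/
lemma sum_dyadic_class_le {M N : ℕ} (hN : 1 ≤ N) (L : Matrix (Fin M) (Fin N) ℝ)
    (Q φ₀ ρ : ℝ) (hQ : 0 < Q) (hφ₀ : 0 < φ₀) (hρ : 0 < ρ) (hρ1 : ρ < 1)
    (hρ2 : 2 * ρ ^ (M + N) = 1)
    (hL : ∀ q : Fin N → ℤ, q ≠ 0 → ‖(fun j => (q j : ℝ))‖ ≤ Q →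
      φ₀ ≤ ‖(fun j => (q j : ℝ))‖ ^ N * ∏ i, distNearestInt (∑ j, L i j * (q j : ℝ)))
    (K : ℕ) (hK : Q ^ N / φ₀ ≤ 2 ^ (K + 1)) (k : Fin M → ℕ) (hk : ∑ i, k i ≤ K)
    (F : Finset (Fin N → ℤ)) (hFQ : ∀ q ∈ F, ∀ j, |(q j : ℝ)| ≤ Q)
    (hF0 : ∀ q ∈ F, ∀ i, 0 < distNearestInt (∑ j, L i j * (q j : ℝ)))
    (hFk : ∀ q ∈ F, ∀ i, (2 : ℝ) ^ k i ≤ (distNearestInt (∑ j, L i j * (q j : ℝ)))⁻¹ ∧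
      (distNearestInt (∑ j, L i j * (q j : ℝ)))⁻¹ < 2 ^ (k i + 1)) :
    ∑ q ∈ F, ∏ i, (distNearestInt (∑ j, L i j * (q j : ℝ)))⁻¹ ≤
      2 ^ M * (5 ^ (M + N) * (M + N).factorial * Q ^ N +
        (4 * (M + N : ℕ)) ^ (M + N - 1) * (2 ^ (K + 1) * ρ ^ (K + 1 - ∑ i, k i))) := by
  set n := K + 1 - ∑ i, k i with hn
  set t := ∑ i, k i with ht
  have hnt : t + n = K + 1 := by omega
  have hprod : ∏ i, ((2 : ℝ)⁻¹ ^ k i) = (2 ^ t)⁻¹ := by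
    rw [Finset.prod_pow_eq_pow_sum, inv_pow]
  have hρn : (ρ ^ n) ^ (M + N) = (2 ^ n)⁻¹ := by
    rw [← pow_mul, mul_comm, pow_mul, ← inv_pow]
    congr 1
    field_simp
    linarith
  have hcard := card_le_of_distNearestInt_le hN L Q φ₀ (ρ ^ n) hQ (by positivity)
    (pow_le_one₀ hρ.le hρ1.le) (fun i => (2 : ℝ)⁻¹ ^ k i) (fun i => by positivity)
    (fun i => pow_le_one₀ (by norm_num) (by norm_num)) hL (by
      rw [hρn, hprod, ← mul_assoc, ← mul_inv, ← pow_add, add_comm n t, hnt, inv_mul_le_iff₀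
        (by positivity)]
      exact (div_le_iff₀ hφ₀).1 hK) F hFQ (fun q hq i => by
      rw [inv_pow]
      exact (le_inv_comm₀ (by positivity) (hF0 q hq i)).1 (hFk q hq i).1)
  rw [hprod] at hcard
  have hterm : ∀ q ∈ F, ∏ i, (distNearestInt (∑ j, L i j * (q j : ℝ)))⁻¹ ≤ 2 ^ M * 2 ^ t := by
    intro q hq
    calc ∏ i, (distNearestInt (∑ j, L i j * (q j : ℝ)))⁻¹ ≤ ∏ i, (2 : ℝ) ^ (k i + 1) :=
          Finset.prod_le_prod (fun i _ => (inv_pos.2 (hF0 q hq i)).le)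
            fun i _ => (hFk q hq i).2.le
      _ = 2 ^ M * 2 ^ t := by
          rw [Finset.prod_pow_eq_pow_sum, Finset.sum_add_distrib]
          simp [pow_add, mul_comm, ht]
  have hpow : (ρ ^ n)⁻¹ ^ (M + N - 1) = 2 ^ n * ρ ^ n := by
    have h1 : (ρ ^ n) ^ (M + N - 1) * ρ ^ n = (2 ^ n)⁻¹ := by
      rw [← pow_succ, Nat.sub_add_cancel (by omega), hρn]
    rw [inv_pow, inv_eq_iff_eq_inv, mul_inv, ← h1]
    field_simp
  calc ∑ q ∈ F, ∏ i, (distNearestInt (∑ j, L i j * (q j : ℝ)))⁻¹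
      ≤ F.card * (2 ^ M * 2 ^ t) := by
        simpa using Finset.sum_le_card_nsmul F _ _ hterm
    _ ≤ (5 ^ (M + N) * (M + N).factorial * (Q ^ N * (2 ^ t)⁻¹) +
        (4 * (M + N : ℕ) / ρ ^ n) ^ (M + N - 1)) * (2 ^ M * 2 ^ t) := by gcongr
    _ = _ := by
        rw [div_eq_mul_inv, mul_pow, hpow, ← hnt, pow_add (2 : ℝ) t n]
        field_simp

/-- **Corollary 1.6**: if `L ∈ ℝ^{M×N}` is `φ`-semi multiplicatively badly approximable, then
for `Q ≥ 2` the sum of reciprocals `∑_{q ∈ [-Q,Q]^N ∩ ℤ^N \ {0}} ∏ᵢ ‖Lᵢ(q)‖⁻¹` is at most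
`c (Q^N log(Q^N/φ(Q))^M + (Q^N/φ(Q)) log(Q^N/φ(Q))^{M-1})` with `c` depending only on `M,N`. -/
theorem sum_reciprocals_fractional_parts (M N : ℕ) (hM : 1 ≤ M) (hN : 1 ≤ N) :
    ∃ c : ℝ, 0 < c ∧
      ∀ φ : ℝ → ℝ, (∀ x, 1 ≤ x → 0 < φ x ∧ φ x ≤ 1) →
        (∀ x y, 1 ≤ x → x ≤ y → φ y ≤ φ x) →
      ∀ L : Matrix (Fin M) (Fin N) ℝ,
        (∀ q : Fin N → ℤ, q ≠ 0 →
          φ ‖(fun j => (q j : ℝ))‖ ≤ ‖(fun j => (q j : ℝ))‖ ^ N *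
            ∏ i, distNearestInt (∑ j, L i j * (q j : ℝ))) →
      ∀ Q : ℝ, 2 ≤ Q →
        ∑ q ∈ (Fintype.piFinset fun _ : Fin N => Finset.Icc (-⌊Q⌋) ⌊Q⌋).erase 0,
            ∏ i, (distNearestInt (∑ j, L i j * (q j : ℝ)))⁻¹ ≤
          c * (Q ^ N * Real.log (Q ^ N / φ Q) ^ M +
               Q ^ N / φ Q * Real.log (Q ^ N / φ Q) ^ (M - 1)) := by
  obtain ⟨m, rfl⟩ : ∃ m, M = m + 1 := ⟨M - 1, by omega⟩
  obtain ⟨ρ, hρ, hρ1, hρ2⟩ := exists_root_two (m + 1 + N) (by omega)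
  have hρ' : 0 < 1 - ρ := sub_pos.2 hρ1
  set a : ℝ := 5 ^ (m + 1 + N) * (m + 1 + N).factorial with ha
  set b : ℝ := (4 * (m + 1 + N : ℕ)) ^ (m + 1 + N - 1) with hb
  have ha0 : 0 < a := by positivity
  have hb0 : 0 < b := by positivity
  set c₁ : ℝ := 2 ^ (m + 1) * a * 3 ^ (m + 1) with hc₁
  set c₂ : ℝ := 2 ^ (m + 1) * b * 2 * 3 ^ m * (1 - ρ)⁻¹ with hc₂
  have hc₁0 : 0 < c₁ := by positivity
  have hc₂0 : 0 < c₂ := by positivity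
  refine ⟨c₁ + c₂, by positivity, ?_⟩
  intro φ hφ hmono L hbad Q hQ
  have hQ0 : 0 < Q := by linarith
  obtain ⟨hφQ, hφQ1⟩ := hφ Q (by linarith)
  set T : ℝ := Q ^ N / φ Q with hT
  have hQN : 2 ≤ Q ^ N := hQ.trans (le_self_pow₀ (by linarith) (by omega))
  have hT2 : 2 ≤ T := hQN.trans (le_div_self (by positivity) hφQ hφQ1)
  have hL : ∀ q : Fin N → ℤ, q ≠ 0 → ‖(fun j => (q j : ℝ))‖ ≤ Q →
      φ Q ≤ ‖(fun j => (q j : ℝ))‖ ^ N * ∏ i, distNearestInt (∑ j, L i j * (q j : ℝ)) := by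
    intro q hq hqQ
    refine (hmono _ _ ?_ hqQ).trans (hbad q hq)
    obtain ⟨j, hj⟩ := Function.ne_iff.1 hq
    have h1 : (1 : ℝ) ≤ |(q j : ℝ)| := by exact_mod_cast Int.one_le_abs hj
    exact h1.trans (norm_le_pi_norm (fun j => (q j : ℝ)) j)
  obtain ⟨K, hK, hK'⟩ := exists_nat_pow_near (by linarith : 1 ≤ T) (one_lt_two (α := ℝ))
  set E := (Fintype.piFinset fun _ : Fin N => Finset.Icc (-⌊Q⌋) ⌊Q⌋).erase 0 with hE
  have hEQ : ∀ q ∈ E, ∀ j, |(q j : ℝ)| ≤ Q := by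
    intro q hq j
    have h := Finset.mem_Icc.1 (Fintype.mem_piFinset.1 (Finset.mem_of_mem_erase hq) j)
    have h1 : |q j| ≤ ⌊Q⌋ := abs_le.2 h
    have h2 : (|(q j : ℝ)|) ≤ ⌊Q⌋ := by exact_mod_cast h1
    exact h2.trans (Int.floor_le Q)
  have hEnorm : ∀ q ∈ E, ‖(fun j => (q j : ℝ))‖ ≤ Q := fun q hq =>
    (pi_norm_le_iff_of_nonneg hQ0.le).2 fun j => hEQ q hq j
  have hE0 : ∀ q ∈ E, ∀ i, 0 < distNearestInt (∑ j, L i j * (q j : ℝ)) := by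
    intro q hq i
    refine lt_of_le_of_ne (abs_nonneg _) fun h => ?_
    have h1 := hL q (Finset.ne_of_mem_erase hq) (hEnorm q hq)
    rw [Finset.prod_eq_zero (Finset.mem_univ i) h.symm, mul_zero] at h1
    linarith
  choose κ hκ using exists_two_pow_near_inv_distNearestInt
  let κ' : (Fin N → ℤ) → Fin (m + 1) → ℕ := fun q i => κ (∑ j, L i j * (q j : ℝ))
  have hprodT : ∀ q ∈ E, ∏ i, (distNearestInt (∑ j, L i j * (q j : ℝ)))⁻¹ ≤ T := by
    intro q hq
    have hp : 0 < ∏ i, distNearestInt (∑ j, L i j * (q j : ℝ)) :=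
      Finset.prod_pos fun i _ => hE0 q hq i
    rw [Finset.prod_inv_distrib, hT, inv_le_iff_one_le_mul₀ hp, div_mul_eq_mul_div,
      le_div_iff₀ hφQ, one_mul]
    refine (hL q (Finset.ne_of_mem_erase hq) (hEnorm q hq)).trans ?_
    gcongr
    exact hEnorm q hq
  have hmaps : ∀ q ∈ E, κ' q ∈ exponentVectors (m + 1) K := by
    intro q hq
    have hsum : ∑ i, κ' q i ≤ K := by
      have h1 : (2 : ℝ) ^ (∑ i, κ' q i) < 2 ^ (K + 1) := by
        rw [← Finset.prod_pow_eq_pow_sum]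
        refine lt_of_le_of_lt ?_ hK'
        refine (Finset.prod_le_prod (fun i _ => by positivity) fun i _ => ?_).trans (hprodT q hq)
        exact (hκ _ (hE0 q hq i)).1
      exact Nat.lt_succ_iff.1 ((pow_lt_pow_iff_right₀ one_lt_two).1 h1)
    simp only [exponentVectors, Finset.mem_filter, Fintype.mem_piFinset, Finset.mem_range]
    exact ⟨fun i => Nat.lt_succ_iff.2
      ((Finset.single_le_sum (fun i _ => Nat.zero_le _) (Finset.mem_univ i)).trans hsum), hsum⟩
  have hlog := succ_le_three_mul_log hT2 hK
  have hlog0 : 0 ≤ Real.log T := Real.log_nonneg (by linarith)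
  rw [← Finset.sum_fiberwise_of_maps_to hmaps]
  calc ∑ k ∈ exponentVectors (m + 1) K, ∑ q ∈ E with κ' q = k,
          ∏ i, (distNearestInt (∑ j, L i j * (q j : ℝ)))⁻¹
      ≤ ∑ k ∈ exponentVectors (m + 1) K,
          2 ^ (m + 1) * (a * Q ^ N + b * (2 ^ (K + 1) * ρ ^ (K + 1 - ∑ i, k i))) := by
        refine Finset.sum_le_sum fun k hk => ?_
        refine sum_dyadic_class_le hN L Q (φ Q) ρ hQ0 hφQ hρ hρ1 hρ2 hL K hK'.le k
          (Finset.mem_filter.1 hk).2 _ (fun q hq => hEQ q (Finset.mem_filter.1 hq).1)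
          (fun q hq => hE0 q (Finset.mem_filter.1 hq).1) fun q hq i => ?_
        obtain ⟨hqE, rfl⟩ := Finset.mem_filter.1 hq
        exact hκ _ (hE0 q hqE i)
    _ = 2 ^ (m + 1) * a * Q ^ N * (exponentVectors (m + 1) K).card +
          2 ^ (m + 1) * b * (2 * 2 ^ K) *
            ∑ k ∈ exponentVectors (m + 1) K, ρ ^ (K + 1 - ∑ i, k i) := by
        rw [← Finset.mul_sum, Finset.sum_add_distrib, Finset.sum_const, ← Finset.mul_sum,
          ← Finset.mul_sum, nsmul_eq_mul]
        ring
    _ ≤ 2 ^ (m + 1) * a * Q ^ N * (3 * Real.log T) ^ (m + 1) +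
          2 ^ (m + 1) * b * (2 * T) * ((3 * Real.log T) ^ m * (1 - ρ)⁻¹) := by
        have h1 : ((exponentVectors (m + 1) K).card : ℝ) ≤ (3 * Real.log T) ^ (m + 1) := by
          refine le_trans ?_ (pow_le_pow_left₀ (by positivity) hlog (m + 1))
          exact_mod_cast card_exponentVectors_le (m + 1) K
        have h2 : ∑ k ∈ exponentVectors (m + 1) K, ρ ^ (K + 1 - ∑ i, k i) ≤
            (3 * Real.log T) ^ m * (1 - ρ)⁻¹ := by
          refine (sum_exponentVectors_pow_le m K ρ hρ.le hρ1).trans ?_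
          gcongr
        gcongr
    _ = c₁ * (Q ^ N * Real.log T ^ (m + 1)) + c₂ * (T * Real.log T ^ m) := by
        rw [hc₁, hc₂, mul_pow, mul_pow]
        ring
    _ ≤ (c₁ + c₂) * (Q ^ N * Real.log T ^ (m + 1) + T * Real.log T ^ (m + 1 - 1)) := by
        rw [Nat.add_sub_cancel]
        have h1 : 0 ≤ Q ^ N * Real.log T ^ (m + 1) := by positivity
        have h2 : 0 ≤ T * Real.log T ^ m := by positivity
        nlinarith [mul_nonneg hc₁0.le h2, mul_nonneg hc₂0.le h1]
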